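/- Let ω be continuously differentiable on [0,1]. The flow force of the uniform stream solution, 𝒮(θ) = ∫₀¹ [ (1/2)·√(θ² − 2Ω(p)) + (Ω(1) − Ω(p) − H(p;θ) + ℛ(θ))·(θ² − 2Ω(p))^{−1/2} ] dp, is differentiable on (θ₀, ∞) and satisfies 𝒮′(θ) = ℛ′(θ)·d(θ). -/

import Mathlib

/-- `Omg ω τ = ∫₀^τ ω(s) ds`. -/
noncomputable def Omg (ω : ℝ → ℝ) (τ : ℝ) : ℝ := ∫ s in (0:ℝ)..τ, ω s

/-- `theta0 ω = √(2 · max_{τ∈[0,1]} Ω(τ))`. -/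
noncomputable def theta0 (ω : ℝ → ℝ) : ℝ := Real.sqrt (2 * sSup (Omg ω '' Set.Icc 0 1))

/-- `Hfun ω θ p = ∫₀^p (θ² − 2Ω(τ))^{−1/2} dτ`. -/
noncomputable def Hfun (ω : ℝ → ℝ) (θ p : ℝ) : ℝ :=
  ∫ τ in (0:ℝ)..p, 1 / Real.sqrt (θ ^ 2 - 2 * Omg ω τ)

/-- `dfun ω θ = H(1;θ)`. -/
noncomputable def dfun (ω : ℝ → ℝ) (θ : ℝ) : ℝ := Hfun ω θ 1

/-- `Rcal ω θ = θ²/2 + d(θ) − Ω(1)`. -/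
noncomputable def Rcal (ω : ℝ → ℝ) (θ : ℝ) : ℝ := θ ^ 2 / 2 + dfun ω θ - Omg ω 1

/-- The uniform-stream flow force
`𝒮(θ) = ∫₀¹ [ (1/2)√(θ²−2Ω(p)) + (Ω(1) − Ω(p) − H(p;θ) + ℛ(θ))·(θ²−2Ω(p))^{−1/2} ] dp`. -/
noncomputable def Scal (ω : ℝ → ℝ) (θ : ℝ) : ℝ :=
  ∫ p in (0:ℝ)..1,
    ((1/2) * Real.sqrt (θ ^ 2 - 2 * Omg ω p)
      + (Omg ω 1 - Omg ω p - Hfun ω θ p + Rcal ω θ) / Real.sqrt (θ ^ 2 - 2 * Omg ω p))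

open Set MeasureTheory

theorem integral_primitive_mul_self {f : ℝ → ℝ} (hf : ContinuousOn f (Icc 0 1)) :
    ∫ x in (0:ℝ)..1, (∫ t in (0:ℝ)..x, f t) * f x = (∫ t in (0:ℝ)..1, f t) ^ 2 / 2 := by
  have hu : uIcc (0:ℝ) 1 = Icc 0 1 := uIcc_of_le zero_le_one
  have hi : IntervalIntegrable f volume 0 1 := by
    apply ContinuousOn.intervalIntegrable; rwa [hu]
  have hc : ContinuousOn (fun x => ∫ t in (0:ℝ)..x, f t) (Icc 0 1) := by
    rw [← hu]
    exact intervalIntegral.continuousOn_primitive_interval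
      (by rw [hu]; exact hf.integrableOn_Icc)
  have key := intervalIntegral.integral_eq_sub_of_hasDerivAt_of_le
    (f := fun x => (∫ t in (0:ℝ)..x, f t) ^ 2 / 2)
    (f' := fun x => (∫ t in (0:ℝ)..x, f t) * f x) zero_le_one
    ((hc.pow 2).div_const 2) ?_ ?_
  · simpa using key
  · intro x hx
    have hd : HasDerivAt (fun x => ∫ t in (0:ℝ)..x, f t) (f x) x := by
      apply intervalIntegral.integral_hasDerivAt_right
      · exact hi.mono_set (uIcc_subset_uIcc left_mem_uIcc (by rw [hu]; exact Ioo_subset_Icc_self hx))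
      · exact (hf.mono Ioo_subset_Icc_self).stronglyMeasurableAtFilter isOpen_Ioo x hx
      · exact hf.continuousAt (Icc_mem_nhds hx.1 hx.2)
    refine ((hd.pow 2).div_const 2).congr_deriv ?_
    push_cast
    ring
  · apply ContinuousOn.intervalIntegrable
    rw [hu]
    exact hc.mul hf

theorem hasDerivAt_integral_comp_sq_sub {φ φ' g : ℝ → ℝ} {θ₀ θ : ℝ}
    (hφ : ∀ x, 0 < x → HasDerivAt φ (φ' x) x) (hφ' : ContinuousOn φ' (Ioi 0))
    (hg : ContinuousOn g (Icc 0 1)) (hpos : ∀ t, θ₀ < t → ∀ p ∈ Icc (0:ℝ) 1, 0 < t ^ 2 - g p)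
    (hθ : θ₀ < θ) :
    HasDerivAt (fun t => ∫ p in (0:ℝ)..1, φ (t ^ 2 - g p))
      (∫ p in (0:ℝ)..1, φ' (θ ^ 2 - g p) * (2 * θ)) θ := by
  have hu : uIcc (0:ℝ) 1 = Icc 0 1 := uIcc_of_le zero_le_one
  have hui : uIoc (0:ℝ) 1 = Ioc 0 1 := uIoc_of_le zero_le_one
  obtain ⟨a, ha, haθ⟩ := exists_between hθ
  have hφc : ContinuousOn φ (Ioi 0) := fun x hx => (hφ x hx).continuousAt.continuousWithinAt
  have hFc : ∀ t, θ₀ < t → IntervalIntegrable (fun p => φ (t ^ 2 - g p)) volume 0 1 := by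
    intro t ht
    apply ContinuousOn.intervalIntegrable
    rw [hu]
    exact hφc.comp (continuousOn_const.sub hg) (hpos t ht)
  have hF'c : ContinuousOn (fun q : ℝ × ℝ => φ' (q.1 ^ 2 - g q.2) * (2 * q.1))
      (Icc a (θ + 1) ×ˢ Icc 0 1) := by
    refine ContinuousOn.mul (hφ'.comp ?_ ?_) (by fun_prop)
    · exact ContinuousOn.sub (by fun_prop) (hg.comp continuousOn_snd fun q hq => hq.2)
    · exact fun q hq => hpos q.1 (ha.trans_le hq.1.1) q.2 hq.2
  obtain ⟨C, hC⟩ := (isCompact_Icc.prod isCompact_Icc).exists_bound_of_continuousOn hF'c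
  have hθm : θ ∈ Icc a (θ + 1) := ⟨haθ.le, by linarith⟩
  refine (intervalIntegral.hasDerivAt_integral_of_dominated_loc_of_deriv_le
    (F := fun t p => φ (t ^ 2 - g p)) (F' := fun t p => φ' (t ^ 2 - g p) * (2 * t))
    (bound := fun _ => C) (Icc_mem_nhds haθ (by linarith : θ < θ + 1)) ?_ (hFc θ hθ) ?_ ?_
    intervalIntegrable_const ?_).2
  · filter_upwards [Ioi_mem_nhds hθ] with t ht
    exact (hFc t ht).def'.aestronglyMeasurable
  · have : IntervalIntegrable (fun p => φ' (θ ^ 2 - g p) * (2 * θ)) volume 0 1 := by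
      apply ContinuousOn.intervalIntegrable
      rw [hu]
      exact hF'c.comp (f := fun p : ℝ => (θ, p)) (by fun_prop) fun p hp => ⟨hθm, hp⟩
    exact this.def'.aestronglyMeasurable
  · refine Filter.Eventually.of_forall fun p hp t ht => hC (t, p) ⟨ht, ?_⟩
    rw [hui] at hp
    exact Ioc_subset_Icc_self hp
  · refine Filter.Eventually.of_forall fun p hp t ht => ?_
    rw [hui] at hp
    have h1 := hφ _ (hpos t (ha.trans_le ht.1) p (Ioc_subset_Icc_self hp))
    have h2 : HasDerivAt (fun t : ℝ => t ^ 2 - g p) (2 * t) t := by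
      simpa using (hasDerivAt_pow 2 t).sub_const (g p)
    exact h1.comp t h2

theorem continuousOn_Omg {ω : ℝ → ℝ} (hω : ContinuousOn ω (Icc 0 1)) :
    ContinuousOn (Omg ω) (Icc 0 1) := by
  have hu : uIcc (0:ℝ) 1 = Icc 0 1 := uIcc_of_le zero_le_one
  have h := intervalIntegral.continuousOn_primitive_interval (a := 0) (b := 1) (f := ω)
    (μ := volume) (by rw [hu]; exact hω.integrableOn_Icc)
  rwa [hu] at h

theorem sq_sub_two_mul_Omg_pos {ω : ℝ → ℝ} (hω : ContinuousOn ω (Icc 0 1)) {θ : ℝ}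
    (hθ : theta0 ω < θ) {p : ℝ} (hp : p ∈ Icc (0:ℝ) 1) : 0 < θ ^ 2 - 2 * Omg ω p := by
  have hle : Omg ω p ≤ sSup (Omg ω '' Icc 0 1) :=
    le_csSup (isCompact_Icc.image_of_continuousOn (continuousOn_Omg hω)).bddAbove
      (mem_image_of_mem _ hp)
  have hlt := (Real.sqrt_lt' ((Real.sqrt_nonneg _).trans_lt hθ)).1 hθ
  linarith

theorem continuousOn_one_div_sqrt {ω : ℝ → ℝ} (hω : ContinuousOn ω (Icc 0 1)) {θ : ℝ}
    (hθ : theta0 ω < θ) :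
    ContinuousOn (fun p => 1 / Real.sqrt (θ ^ 2 - 2 * Omg ω p)) (Icc 0 1) := by
  refine continuousOn_const.div ?_ fun p hp =>
    (Real.sqrt_pos.2 (sq_sub_two_mul_Omg_pos hω hθ hp)).ne'
  exact (continuousOn_const.sub (continuousOn_const.mul (continuousOn_Omg hω))).sqrt

theorem differentiableAt_dfun {ω : ℝ → ℝ} (hω : ContinuousOn ω (Icc 0 1)) {θ : ℝ}
    (hθ : theta0 ω < θ) : DifferentiableAt ℝ (dfun ω) θ := by
  refine (hasDerivAt_integral_comp_sq_sub (φ := fun x => 1 / Real.sqrt x)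
    (φ' := fun x => -(1 / (2 * Real.sqrt x)) / Real.sqrt x ^ 2) (g := fun p => 2 * Omg ω p)
    (fun x hx => ?_) ?_ (continuousOn_const.mul (continuousOn_Omg hω))
    (fun t ht p hp => sq_sub_two_mul_Omg_pos hω ht hp) hθ).differentiableAt
  · have h := (Real.hasDerivAt_sqrt hx.ne').inv (Real.sqrt_pos.2 hx).ne'
    simp only [one_div] at h ⊢
    exact h
  · have hne : ∀ x ∈ Ioi (0:ℝ), Real.sqrt x ≠ 0 := fun x hx => (Real.sqrt_pos.2 hx).ne'
    have hs : ContinuousOn Real.sqrt (Ioi 0) := Real.continuous_sqrt.continuousOn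
    exact ((continuousOn_const.div (continuousOn_const.mul hs) fun x hx =>
      mul_ne_zero two_ne_zero (hne x hx)).neg).div (hs.pow 2) fun x hx => pow_ne_zero 2 (hne x hx)

theorem hasDerivAt_integral_sqrt {ω : ℝ → ℝ} (hω : ContinuousOn ω (Icc 0 1)) {θ : ℝ}
    (hθ : theta0 ω < θ) :
    HasDerivAt (fun t => ∫ p in (0:ℝ)..1, Real.sqrt (t ^ 2 - 2 * Omg ω p)) (θ * dfun ω θ) θ := by
  have h := hasDerivAt_integral_comp_sq_sub (φ := Real.sqrt)
    (φ' := fun x => 1 / (2 * Real.sqrt x)) (g := fun p => 2 * Omg ω p)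
    (fun x hx => Real.hasDerivAt_sqrt hx.ne')
    (continuousOn_const.div (continuousOn_const.mul Real.continuous_sqrt.continuousOn) fun x hx =>
      mul_ne_zero two_ne_zero (Real.sqrt_pos.2 hx).ne')
    (continuousOn_const.mul (continuousOn_Omg hω))
    (fun t ht p hp => sq_sub_two_mul_Omg_pos hω ht hp) hθ
  convert h using 1
  rw [dfun, Hfun, ← intervalIntegral.integral_const_mul]
  congr 1
  ext p
  ring

theorem Scal_eq {ω : ℝ → ℝ} (hω : ContinuousOn ω (Icc 0 1)) {θ : ℝ} (hθ : theta0 ω < θ) :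
    Scal ω θ = (∫ p in (0:ℝ)..1, Real.sqrt (θ ^ 2 - 2 * Omg ω p)) + dfun ω θ ^ 2 / 2 := by
  have hu : uIcc (0:ℝ) 1 = Icc 0 1 := uIcc_of_le zero_le_one
  set f : ℝ → ℝ := fun p => 1 / Real.sqrt (θ ^ 2 - 2 * Omg ω p) with hf
  have hfc : ContinuousOn f (Icc 0 1) := continuousOn_one_div_sqrt hω hθ
  have hHc : ContinuousOn (Hfun ω θ) (Icc 0 1) := by
    have h := intervalIntegral.continuousOn_primitive_interval (a := 0) (b := 1) (f := f)
      (μ := volume) (by rw [hu]; exact hfc.integrableOn_Icc)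
    rwa [hu] at h
  have hsi : IntervalIntegrable (fun p => Real.sqrt (θ ^ 2 - 2 * Omg ω p)) volume 0 1 := by
    apply ContinuousOn.intervalIntegrable
    rw [hu]
    exact (continuousOn_const.sub (continuousOn_const.mul (continuousOn_Omg hω))).sqrt
  have hfi : IntervalIntegrable (fun p => dfun ω θ * f p) volume 0 1 := by
    apply ContinuousOn.intervalIntegrable
    rw [hu]
    exact continuousOn_const.mul hfc
  have hHi : IntervalIntegrable (fun p => Hfun ω θ p * f p) volume 0 1 := by
    apply ContinuousOn.intervalIntegrable
    rw [hu]
    exact hHc.mul hfc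
  have hS : Scal ω θ = ∫ p in (0:ℝ)..1,
      (Real.sqrt (θ ^ 2 - 2 * Omg ω p) + (dfun ω θ * f p - Hfun ω θ p * f p)) := by
    refine intervalIntegral.integral_congr fun p hp => ?_
    rw [hu] at hp
    have hpos := sq_sub_two_mul_Omg_pos hω hθ hp
    have hs := Real.sqrt_pos.2 hpos
    have hsq := Real.sq_sqrt hpos.le
    simp only [hf, Rcal]
    field_simp
    linear_combination -hsq
  rw [hS, intervalIntegral.integral_add hsi (hfi.sub hHi), intervalIntegral.integral_sub hfi hHi,
    intervalIntegral.integral_const_mul]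
  have hprim : ∫ p in (0:ℝ)..1, Hfun ω θ p * f p = dfun ω θ ^ 2 / 2 :=
    integral_primitive_mul_self hfc
  have hd : ∫ p in (0:ℝ)..1, f p = dfun ω θ := rfl
  rw [hprim, hd]
  ring

/-- the uniform-stream flow force `𝒮` is differentiable on `(θ₀,∞)` and satisfies
`𝒮′(θ) = ℛ′(θ)·d(θ)`. -/
theorem stmt7 (ω : ℝ → ℝ) (hω : ContDiffOn ℝ 1 ω (Set.Icc 0 1)) :
    ∀ θ ∈ Set.Ioi (theta0 ω),
      HasDerivAt (Scal ω) (deriv (Rcal ω) θ * dfun ω θ) θ := by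
  intro θ hθ
  have hc := hω.continuousOn
  have hd := (differentiableAt_dfun hc hθ).hasDerivAt
  have hR : HasDerivAt (Rcal ω) (θ + deriv (dfun ω) θ) θ := by
    refine ((((hasDerivAt_pow 2 θ).div_const 2).add hd).sub_const (Omg ω 1)).congr_deriv ?_
    simp
  have hS := (hasDerivAt_integral_sqrt hc hθ).add ((hd.pow 2).div_const 2)
  rw [hR.deriv]
  refine (hS.congr_of_eventuallyEq ?_).congr_deriv ?_
  · filter_upwards [Ioi_mem_nhds hθ] with t ht
    exact Scal_eq hc ht
  · simp
    ring
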